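/- arXiv:1706.04381 — 3 statements merged into one kernel-verified Lean document; each statement's English description precedes it below -/
import Mathlib

section
/- Let f : ℝ^p → ℝ be differentiable, L-smooth and m-strongly convex with 0 < m ≤ L, let x⋆ be the unique point with ∇f(x⋆) = 0, and let α, β ∈ ℝ and 0 ≤ ρ ≤ 1. Given x_k, x_{k−1} ∈ ℝ^p, set y_k = (1+β)x_k − βx_{k−1} and x_{k+1} = y_k − α∇f(y_k). Define Q₁ := (1/2)·( m‖x_k − y_k‖² + 2⟨∇f(y_k), x_k − y_k⟩ + α(2 − Lα)‖∇f(y_k)‖² ) and Q₂ := (1/2)·( m‖y_k − x⋆‖² − 2⟨∇f(y_k), y_k − x⋆⟩ + α(2 − Lα)‖∇f(y_k)‖² ). Then ρ²Q₁ + (1 − ρ²)Q₂ ≤ ρ²(f(x_k) − f(x⋆)) − (f(x_{k+1}) − f(x⋆)). -/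
open RealInnerProductSpace

/-- The descent lemma: a differentiable function with `L`-Lipschitz gradient lies below its
quadratic upper model. -/
theorem le_add_inner_gradient_add_sq {E : Type*} [NormedAddCommGroup E] [InnerProductSpace ℝ E]
    [CompleteSpace E] {f : E → ℝ} {L : ℝ} (hf : Differentiable ℝ f)
    (hL : ∀ x y, ‖gradient f x - gradient f y‖ ≤ L * ‖x - y‖) (x v : E) :
    f (x + v) ≤ f x + ⟪gradient f x, v⟫ + L / 2 * ‖v‖ ^ 2 := by
  have hline (t : ℝ) : HasDerivAt (fun s : ℝ => f (x + s • v)) ⟪gradient f (x + t • v), v⟫ t := by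
    have h1 : HasDerivAt (fun s : ℝ => x + s • v) v t := by
      simpa using ((hasDerivAt_id t).smul_const v).const_add x
    have h2 := (hf (x + t • v)).hasGradientAt.hasFDerivAt.comp_hasDerivAt t h1
    simpa [Function.comp_def] using h2
  have hmodel (t : ℝ) : HasDerivAt
      (fun s : ℝ => f x + s * ⟪gradient f x, v⟫ + L / 2 * ‖v‖ ^ 2 * s ^ 2)
      (⟪gradient f x, v⟫ + L * ‖v‖ ^ 2 * t) t := by
    have h1 := ((hasDerivAt_id t).mul_const ⟪gradient f x, v⟫).const_add (f x)
    have h2 := (hasDerivAt_pow 2 t).const_mul (L / 2 * ‖v‖ ^ 2)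
    refine (h1.add h2).congr_deriv ?_
    norm_num
    ring
  have key := image_le_of_deriv_right_le_deriv_boundary (a := 0) (b := 1)
    (fun t _ => (hline t).continuousAt.continuousWithinAt)
    (fun t _ => (hline t).hasDerivWithinAt) (by simp)
    (fun t _ => (hmodel t).continuousAt.continuousWithinAt)
    (fun t _ => (hmodel t).hasDerivWithinAt)
    (fun t ht => by
      have h1 := real_inner_le_norm (gradient f (x + t • v) - gradient f x) v
      have h2 := hL (x + t • v) x
      rw [add_sub_cancel_left, norm_smul, Real.norm_of_nonneg ht.1] at h2
      rw [inner_sub_left] at h1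
      nlinarith [mul_le_mul_of_nonneg_right h2 (norm_nonneg v)])
    (Set.right_mem_Icc.2 zero_le_one)
  simpa using key

/-- Combined supply-rate condition of Lemma 3 for Nesterov's accelerated method:
`ρ²Q₁ + (1 − ρ²)Q₂ ≤ ρ²(f(x_k) − f(x⋆)) − (f(x_{k+1}) − f(x⋆))`. -/
theorem nesterov_supply_rate_combined {p : ℕ} (f : EuclideanSpace ℝ (Fin p) → ℝ)
    (L m : ℝ) (hm : 0 < m) (hmL : m ≤ L)
    (hf : Differentiable ℝ f)
    (hsmooth : ∀ x y, ‖gradient f x - gradient f y‖ ≤ L * ‖x - y‖)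
    (hsc : ∀ x y, f x ≥ f y + ⟪gradient f y, x - y⟫ + m / 2 * ‖x - y‖ ^ 2)
    (xs : EuclideanSpace ℝ (Fin p)) (hxs : gradient f xs = 0)
    (α β ρ : ℝ) (hρ0 : 0 ≤ ρ) (hρ1 : ρ ≤ 1)
    (xk xkm1 yk xkp1 : EuclideanSpace ℝ (Fin p))
    (hy : yk = (1 + β) • xk - β • xkm1)
    (hx : xkp1 = yk - α • gradient f yk)
    (Q₁ Q₂ : ℝ)
    (hQ1 : Q₁ = 1 / 2 * (m * ‖xk - yk‖ ^ 2 + 2 * ⟪gradient f yk, xk - yk⟫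
        + α * (2 - L * α) * ‖gradient f yk‖ ^ 2))
    (hQ2 : Q₂ = 1 / 2 * (m * ‖yk - xs‖ ^ 2 - 2 * ⟪gradient f yk, yk - xs⟫
        + α * (2 - L * α) * ‖gradient f yk‖ ^ 2)) :
    ρ ^ 2 * Q₁ + (1 - ρ ^ 2) * Q₂ ≤ ρ ^ 2 * (f xk - f xs) - (f xkp1 - f xs) := by
  have hdesc := le_add_inner_gradient_add_sq hf hsmooth yk (-(α • gradient f yk))
  rw [← sub_eq_add_neg, ← hx, inner_neg_right, real_inner_smul_right,
    real_inner_self_eq_norm_sq, norm_neg, norm_smul, mul_pow, Real.norm_eq_abs, sq_abs] at hdesc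
  have hQ1_le : Q₁ ≤ f xk - f xkp1 := by
    rw [hQ1]
    linarith [hsc xk yk]
  have hQ2_le : Q₂ ≤ f xs - f xkp1 := by
    have h := hsc xs yk
    rw [← neg_sub yk xs, inner_neg_right, norm_neg] at h
    rw [hQ2]
    linarith
  have hρ : ρ ^ 2 ≤ 1 := pow_le_one₀ hρ0 hρ1
  linarith [mul_le_mul_of_nonneg_left hQ1_le (sq_nonneg ρ),
    mul_le_mul_of_nonneg_left hQ2_le (sub_nonneg.2 hρ)]
end

section
/- Let f : ℝ^p → ℝ be differentiable, L-smooth and m-strongly convex with 0 < m ≤ L, let x⋆ be the unique point with ∇f(x⋆) = 0, and let α, β, η ∈ ℝ with δ = β − η. Given x_k, x_{k−1} ∈ ℝ^p, set y_k = (1+η)x_k − ηx_{k−1}, x_{k+1} = (1+β)x_k − βx_{k−1} − α∇f(y_k), and d = x_k − x_{k−1}. Then (1/2)·( −Lδ²‖d‖² − 2(1 − Lα)δ⟨∇f(y_k), d⟩ + α(2 − Lα)‖∇f(y_k)‖² + m‖y_k − x⋆‖² − 2⟨∇f(y_k), y_k − x⋆⟩ ) ≤ f(x⋆) − f(x_{k+1}).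 -/
open RealInnerProductSpace

/-- The **descent lemma**: a differentiable function with `L`-Lipschitz gradient lies below its
quadratic upper model. -/
theorem le_quadratic_model_of_gradient_lipschitz {E : Type*} [NormedAddCommGroup E]
    [InnerProductSpace ℝ E] [CompleteSpace E] {f : E → ℝ} {L : ℝ} (hf : Differentiable ℝ f)
    (hsmooth : ∀ x y, ‖gradient f x - gradient f y‖ ≤ L * ‖x - y‖) (y v : E) :
    f (y + v) ≤ f y + ⟪gradient f y, v⟫ + L / 2 * ‖v‖ ^ 2 := by
  have hderiv (t : ℝ) : HasDerivAt
      (fun t : ℝ ↦ f (y + t • v) - t * ⟪gradient f y, v⟫ - t ^ 2 * (L / 2 * ‖v‖ ^ 2))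
      (⟪gradient f (y + t • v), v⟫ - ⟪gradient f y, v⟫ - 2 * t * (L / 2 * ‖v‖ ^ 2)) t := by
    have hline : HasDerivAt (fun t : ℝ ↦ y + t • v) v t := by
      simpa using ((hasDerivAt_id t).smul_const v).const_add y
    have hcomp := (hf (y + t • v)).hasGradientAt.hasFDerivAt.comp_hasDerivAt t hline
    rw [InnerProductSpace.toDual_apply_apply] at hcomp
    refine (hcomp.sub ?_).sub ?_
    · simpa using (hasDerivAt_id t).mul_const ⟪gradient f y, v⟫
    · simpa using (hasDerivAt_pow 2 t).mul_const (L / 2 * ‖v‖ ^ 2)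
  have hanti := antitoneOn_of_hasDerivWithinAt_nonpos (convex_Icc (0 : ℝ) 1)
    (fun t _ ↦ (hderiv t).continuousAt.continuousWithinAt)
    (fun t _ ↦ (hderiv t).hasDerivWithinAt) (fun t ht ↦ by
      rw [interior_Icc] at ht
      have hinner := real_inner_le_norm (gradient f (y + t • v) - gradient f y) v
      have hlip := mul_le_mul_of_nonneg_right (hsmooth (y + t • v) y) (norm_nonneg v)
      rw [add_sub_cancel_left, norm_smul, Real.norm_of_nonneg ht.1.le] at hlip
      rw [inner_sub_left] at hinner
      linarith)
  have h := hanti (Set.left_mem_Icc.2 zero_le_one) (Set.right_mem_Icc.2 zero_le_one) zero_le_one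
  simp only [one_smul, zero_smul, add_zero] at h
  linarith

/-- Second inequality (weight matrix `X₁ + X₃`) of Lemma 5 for the general accelerated method
`x_{k+1} = (1+β)x_k − βx_{k−1} − α∇f(y_k)`, `y_k = (1+η)x_k − ηx_{k−1}`. -/
theorem general_accelerated_supply_rate_X1X3 {p : ℕ} (f : EuclideanSpace ℝ (Fin p) → ℝ)
    (L m : ℝ) (hm : 0 < m) (hmL : m ≤ L)
    (hf : Differentiable ℝ f)
    (hsmooth : ∀ x y, ‖gradient f x - gradient f y‖ ≤ L * ‖x - y‖)
    (hsc : ∀ x y, f x ≥ f y + ⟪gradient f y, x - y⟫ + m / 2 * ‖x - y‖ ^ 2)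
    (xs : EuclideanSpace ℝ (Fin p)) (hxs : gradient f xs = 0)
    (α β η δ : ℝ) (hδ : δ = β - η)
    (xk xkm1 yk xkp1 d : EuclideanSpace ℝ (Fin p))
    (hy : yk = (1 + η) • xk - η • xkm1)
    (hx : xkp1 = (1 + β) • xk - β • xkm1 - α • gradient f yk)
    (hd : d = xk - xkm1) :
    1 / 2 * (-(L * δ ^ 2) * ‖d‖ ^ 2 - 2 * (1 - L * α) * δ * ⟪gradient f yk, d⟫
        + α * (2 - L * α) * ‖gradient f yk‖ ^ 2
        + m * ‖yk - xs‖ ^ 2 - 2 * ⟪gradient f yk, yk - xs⟫) ≤ f xs - f xkp1 := by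
  have hstep : xkp1 = yk + (δ • d - α • gradient f yk) := by
    rw [hx, hδ, hd]
    nth_rw 2 [hy]
    module
  have hupper := le_quadratic_model_of_gradient_lipschitz hf hsmooth yk
    (δ • d - α • gradient f yk)
  have hlower := hsc xs yk
  rw [← hstep, norm_sub_sq_real, inner_sub_right] at hupper
  simp only [real_inner_smul_left, real_inner_smul_right, norm_smul, mul_pow, Real.norm_eq_abs,
    sq_abs, real_inner_self_eq_norm_sq, real_inner_comm (gradient f yk) d] at hupper
  rw [← neg_sub yk xs, inner_neg_right, norm_neg] at hlower
  linarith
end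

section
/- Let f : ℝ^p → ℝ be differentiable, convex and L-smooth with L > 0, and let x⋆ be a point with ∇f(x⋆) = 0. Define ζ_{−1} = 0 and ζ_{k+1} = (1 + √(1 + 4ζ_k²))/2 for k ≥ −1, and β_k = (ζ_{k−1} − 1)/ζ_k. Consider Nesterov's accelerated method with time-varying parameters: y_k = (1+β_k)x_k − β_kx_{k−1}, x_{k+1} = y_k − (1/L)∇f(y_k), initialized with x_{−1} = x₀ ∈ ℝ^p. Then for every k ≥ 1, f(x_k) − f(x⋆) ≤ (L/2)‖x₀ − x⋆‖²/ζ_{k−1}², and since ζ_{k−1} ≥ k/2 for all k ≥ 1, f(x_k) − f(x⋆) ≤ 2L‖x₀ − x⋆‖²/k². -/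
open RealInnerProductSpace

/-- The descent lemma: a function with `L`-Lipschitz gradient lies below its quadratic upper
model. -/
theorem le_quadratic_of_lipschitz_gradient {E : Type*} [NormedAddCommGroup E]
    [InnerProductSpace ℝ E] [CompleteSpace E] {f : E → ℝ} {L : ℝ} (hf : Differentiable ℝ f)
    (hsmooth : ∀ x y, ‖gradient f x - gradient f y‖ ≤ L * ‖x - y‖) (y d : E) :
    f (y + d) ≤ f y + ⟪gradient f y, d⟫ + L / 2 * ‖d‖ ^ 2 := by
  let h : ℝ → ℝ := fun t => f (y + t • d) - t * ⟪gradient f y, d⟫ - t ^ 2 * (L / 2 * ‖d‖ ^ 2)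
  have hder (t : ℝ) : HasDerivAt h
      (⟪gradient f (y + t • d), d⟫ - ⟪gradient f y, d⟫ - 2 * t * (L / 2 * ‖d‖ ^ 2)) t := by
    have hline : HasDerivAt (fun s : ℝ => y + s • d) d t := by
      simpa using ((hasDerivAt_id t).smul_const d).const_add y
    have hcomp := (hf (y + t • d)).hasGradientAt.hasFDerivAt.comp_hasDerivAt t hline
    rw [InnerProductSpace.toDual_apply_apply] at hcomp
    have hlin := (hasDerivAt_id t).mul_const ⟪gradient f y, d⟫
    have hsq := (hasDerivAt_pow 2 t).mul_const (L / 2 * ‖d‖ ^ 2)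
    exact ((hcomp.sub hlin).sub hsq).congr_deriv (by simp)
  have hanti : AntitoneOn h (Set.Ici 0) := by
    refine antitoneOn_of_deriv_nonpos (convex_Ici 0)
      (fun t _ => (hder t).continuousAt.continuousWithinAt)
      (fun t _ => (hder t).differentiableAt.differentiableWithinAt) fun t ht => ?_
    rw [interior_Ici, Set.mem_Ioi] at ht
    rw [(hder t).deriv, ← inner_sub_left]
    have hcs := real_inner_le_norm (gradient f (y + t • d) - gradient f y) d
    have hlip := hsmooth (y + t • d) y
    rw [add_sub_cancel_left, norm_smul, Real.norm_of_nonneg ht.le] at hlip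
    nlinarith [mul_le_mul_of_nonneg_right hlip (norm_nonneg d)]
  have h01 := hanti (Set.mem_Ici.2 le_rfl) (Set.mem_Ici.2 zero_le_one) zero_le_one
  simp only [h, one_smul, zero_smul, add_zero] at h01
  linarith

/-- One step of the accelerated method, started from an extrapolated point `y`, does not increase
the Lyapunov function `a² (f x - f z) + L / 2 * ‖u‖²`, where `u = b • (y - x) + x - z`. -/
theorem accelerated_step_lyapunov_le {E : Type*} [NormedAddCommGroup E]
    [InnerProductSpace ℝ E] [CompleteSpace E] {f : E → ℝ} {L : ℝ} (hL : 0 < L)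
    (hf : Differentiable ℝ f) (hconv : ∀ x y, f x ≥ f y + ⟪gradient f y, x - y⟫)
    (hsmooth : ∀ x y, ‖gradient f x - gradient f y‖ ≤ L * ‖x - y‖)
    {a b : ℝ} (hb : 1 ≤ b) (hab : b ^ 2 - b = a ^ 2) (x y z : E) :
    b ^ 2 * (f (y - (1 / L) • gradient f y) - f z)
        + L / 2 * ‖b • (y - (1 / L) • gradient f y) + (1 - b) • x - z‖ ^ 2
      ≤ a ^ 2 * (f x - f z) + L / 2 * ‖b • (y - x) + x - z‖ ^ 2 := by
  have hdesc := le_quadratic_of_lipschitz_gradient hf hsmooth y (-((1 / L) • gradient f y))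
  have hx := hconv x y
  have hz := hconv z y
  set g := gradient f y
  set u := b • (y - x) + x - z with hu
  have hnext : b • (y - (1 / L) • g) + (1 - b) • x - z = u - (b / L) • g := by
    rw [hu]
    module
  have hcomb : (b - 1) * ⟪g, x - y⟫ + ⟪g, z - y⟫ = -⟪u, g⟫ := by
    rw [real_inner_comm g u, ← real_inner_smul_right, ← inner_add_right, ← inner_neg_right]
    congr 1
    rw [hu]
    module
  have hnorm : L / 2 * ‖u - (b / L) • g‖ ^ 2
      = L / 2 * ‖u‖ ^ 2 - b * ⟪u, g⟫ + b ^ 2 * (‖g‖ ^ 2 / (2 * L)) := by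
    rw [norm_sub_sq_real, real_inner_smul_right, norm_smul, mul_pow, Real.norm_eq_abs, sq_abs]
    field_simp
  have hdecrease : f (y - (1 / L) • g) ≤ f y - ‖g‖ ^ 2 / (2 * L) := by
    rw [← sub_eq_add_neg, inner_neg_right, real_inner_smul_right, real_inner_self_eq_norm_sq,
      norm_neg, norm_smul, mul_pow, Real.norm_eq_abs, sq_abs] at hdesc
    refine hdesc.trans_eq ?_
    field_simp
    ring
  rw [hnext, hnorm, ← hab]
  have hbb : 0 ≤ b * (b - 1) := mul_nonneg (by linarith) (by linarith)
  have h1 := mul_le_mul_of_nonneg_left hdecrease (sq_nonneg b)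
  have h2 := mul_le_mul_of_nonneg_left hx hbb
  have h3 := mul_le_mul_of_nonneg_left hz (by linarith : 0 ≤ b)
  linear_combination h1 + h2 + h3 - b * hcomb

/-- The `O(1/k²)` rate for Nesterov's accelerated method with time-varying parameters.
Here `ζ k` denotes the paper's `ζ_{k−1}`, so `ζ 0 = ζ_{−1} = 0`,
`β_k = (ζ_{k−1} − 1)/ζ_k = (ζ k − 1)/ζ (k+1)`, and `x_{−1} = x₀` is encoded via `xm 0 = x 0`. -/
theorem nesterov_sublinear_rate {p : ℕ} (f : EuclideanSpace ℝ (Fin p) → ℝ)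
    (L : ℝ) (hL : 0 < L)
    (hf : Differentiable ℝ f)
    (hconv : ∀ x y, f x ≥ f y + ⟪gradient f y, x - y⟫)
    (hsmooth : ∀ x y, ‖gradient f x - gradient f y‖ ≤ L * ‖x - y‖)
    (xs : EuclideanSpace ℝ (Fin p)) (hxs : gradient f xs = 0)
    (ζ : ℕ → ℝ) (hζ0 : ζ 0 = 0)
    (hζ : ∀ k, ζ (k + 1) = (1 + Real.sqrt (1 + 4 * (ζ k) ^ 2)) / 2)
    (β : ℕ → ℝ) (hβ : ∀ k, β k = (ζ k - 1) / ζ (k + 1))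
    (x xm : ℕ → EuclideanSpace ℝ (Fin p))
    (hinit : xm 0 = x 0) (hxm : ∀ k, xm (k + 1) = x k)
    (hiter : ∀ k, x (k + 1) = ((1 + β k) • x k - β k • xm k)
        - (1 / L) • gradient f ((1 + β k) • x k - β k • xm k)) :
    ∀ k : ℕ, 1 ≤ k →
      (k : ℝ) / 2 ≤ ζ k ∧
      f (x k) - f xs ≤ L / 2 * ‖x 0 - xs‖ ^ 2 / (ζ k) ^ 2 ∧
      f (x k) - f xs ≤ 2 * L * ‖x 0 - xs‖ ^ 2 / (k : ℝ) ^ 2 := by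
  have hroot (k : ℕ) : 2 * ζ k ≤ √(1 + 4 * ζ k ^ 2) :=
    Real.le_sqrt_of_sq_le (by linarith [mul_pow 2 (ζ k) 2])
  have hgrow (k : ℕ) : ζ k + 1 / 2 ≤ ζ (k + 1) := by
    rw [hζ]
    linarith [hroot k]
  have hquad (k : ℕ) : ζ (k + 1) ^ 2 - ζ (k + 1) = ζ k ^ 2 := by
    have hsq := Real.sq_sqrt (show 0 ≤ 1 + 4 * ζ k ^ 2 by positivity)
    rw [hζ]
    linear_combination hsq / 4
  have hone (k : ℕ) : 1 ≤ ζ (k + 1) := by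
    have := Real.one_le_sqrt.2 (show 1 ≤ 1 + 4 * ζ k ^ 2 by linarith [sq_nonneg (ζ k)])
    rw [hζ]
    linarith
  have hlower (k : ℕ) : (k : ℝ) / 2 ≤ ζ k := by
    induction k with
    | zero => simp [hζ0]
    | succ k ih =>
      push_cast
      linarith [hgrow k]
  have hlyap (k : ℕ) : ζ k ^ 2 * (f (x k) - f xs)
      + L / 2 * ‖ζ k • x k + (1 - ζ k) • xm k - xs‖ ^ 2 ≤ L / 2 * ‖x 0 - xs‖ ^ 2 := by
    induction k with
    | zero => simp [hζ0, hinit]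
    | succ k ih =>
      have hstep := accelerated_step_lyapunov_le hL hf hconv hsmooth (hone k) (hquad k) (x k)
        ((1 + β k) • x k - β k • xm k) xs
      have hβζ : ζ (k + 1) * β k = ζ k - 1 := by
        rw [hβ, mul_div_cancel₀ _ (by linarith [hone k])]
      have hextrap : ζ (k + 1) • ((1 + β k) • x k - β k • xm k - x k) + x k - xs
          = ζ k • x k + (1 - ζ k) • xm k - xs := by
        rw [show ζ k = ζ (k + 1) * β k + 1 by linarith]
        module
      rw [← hiter, hextrap] at hstep
      rw [hxm]
      exact hstep.trans ih
  intro k hk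
  have hk0 : (0 : ℝ) < k := by exact_mod_cast hk
  have hζk : 0 < ζ k := by linarith [hlower k]
  have hrate : f (x k) - f xs ≤ L / 2 * ‖x 0 - xs‖ ^ 2 / ζ k ^ 2 := by
    rw [le_div_iff₀ (by positivity), mul_comm]
    exact (le_add_of_nonneg_right (by positivity)).trans (hlyap k)
  refine ⟨hlower k, hrate, hrate.trans ?_⟩
  calc L / 2 * ‖x 0 - xs‖ ^ 2 / ζ k ^ 2
      ≤ L / 2 * ‖x 0 - xs‖ ^ 2 / ((k : ℝ) / 2) ^ 2 := by
        gcongr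
        exact hlower k
    _ = 2 * L * ‖x 0 - xs‖ ^ 2 / (k : ℝ) ^ 2 := by
        field_simp
end
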